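/- Let R be a unital ring and N a unital R-bimodule. Every derivation d : R → N induces a derivation d̄ : Mₙ(R) → Mₙ(N) defined entrywise by (d̄(A))ᵢⱼ = d(aᵢⱼ). Moreover, if δ : Mₙ(R) → Mₙ(N) is any derivation, then there exist G ∈ Mₙ(N) and a derivation d : R → N such that δ(A) = d̄(A) + AG - GA for all A ∈ Mₙ(R). -/

import Mathlib

/-- A (not necessarily unital) bimodule structure of a ring `A` on an
additive group `M`, given by a left action `l` and a right action `r`. -/
structure RingBimod (A M : Type*) [Ring A] [AddCommGroup M] where
  l : A → M → M
  r : M → A → M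
  l_add : ∀ a m₁ m₂, l a (m₁ + m₂) = l a m₁ + l a m₂
  add_l : ∀ a₁ a₂ m, l (a₁ + a₂) m = l a₁ m + l a₂ m
  r_add : ∀ m₁ m₂ a, r (m₁ + m₂) a = r m₁ a + r m₂ a
  add_r : ∀ m a₁ a₂, r m (a₁ + a₂) = r m a₁ + r m a₂
  mul_l : ∀ a₁ a₂ m, l (a₁ * a₂) m = l a₁ (l a₂ m)
  r_mul : ∀ m a₁ a₂, r m (a₁ * a₂) = r (r m a₁) a₂
  l_r : ∀ a₁ m a₂, l a₁ (r m a₂) = r (l a₁ m) a₂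

namespace RingBimod

variable {A M : Type*} [Ring A] [AddCommGroup M] (bm : RingBimod A M)

/-- The left action as a biadditive map. -/
def lHom : A →+ M →+ M :=
  AddMonoidHom.mk' (fun a => AddMonoidHom.mk' (bm.l a) (bm.l_add a))
    fun a b => AddMonoidHom.ext (bm.add_l a b)

/-- The right action as a biadditive map. -/
def rHom : M →+ A →+ M :=
  AddMonoidHom.mk' (fun m => AddMonoidHom.mk' (bm.r m) (bm.add_r m))
    fun m₁ m₂ => AddMonoidHom.ext (bm.r_add m₁ m₂)

theorem zero_l (m : M) : bm.l 0 m = 0 := DFunLike.congr_fun (map_zero bm.lHom) m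

theorem r_zero (m : M) : bm.r m 0 = 0 := map_zero (bm.rHom m)

theorem l_neg (a : A) (m : M) : bm.l a (-m) = -bm.l a m := map_neg (bm.lHom a) m

variable {ι : Type*} [Fintype ι]

/-- Entrywise application of a derivation satisfies the Leibniz rule for matrix products. -/
theorem entrywise_leibniz {d : A → M} (hadd : ∀ a b, d (a + b) = d a + d b)
    (hmul : ∀ a b, d (a * b) = bm.r (d a) b + bm.l a (d b)) (S T : Matrix ι ι A) (i j : ι) :
    d ((S * T) i j) = ∑ k, bm.r (d (S i k)) (T k j) + ∑ k, bm.l (S i k) (d (T k j)) := by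
  rw [Matrix.mul_apply, ← Finset.sum_add_distrib]
  simp only [← hmul]
  exact map_sum (AddMonoidHom.mk' d hadd) _ _

variable [DecidableEq ι]

theorem sum_l_single (i j : ι) (a : A) (x : ι → M) :
    ∑ k, bm.l (Matrix.single i j a i k) (x k) = bm.l a (x j) := by
  rw [Finset.sum_eq_single j]
  · simp
  · intro k _ hk
    simp [hk.symm, bm.zero_l]
  · simp

theorem sum_r_single (i j : ι) (a : A) (x : ι → M) :
    ∑ k, bm.r (x k) (Matrix.single i j a k j) = bm.r (x i) a := by
  rw [Finset.sum_eq_single i]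
  · simp
  · intro k _ hk
    simp [hk.symm, bm.r_zero]
  · simp

/-- The diagonal corner of a derivation of matrices satisfies the Leibniz rule. -/
theorem corner_leibniz {δ : Matrix ι ι A → Matrix ι ι M}
    (hmul : ∀ S T i j, δ (S * T) i j =
      ∑ k, bm.r (δ S i k) (T k j) + ∑ k, bm.l (S i k) (δ T k j))
    (o : ι) (a b : A) :
    δ (Matrix.single o o (a * b)) o o =
      bm.r (δ (Matrix.single o o a) o o) b + bm.l a (δ (Matrix.single o o b) o o) := by
  rw [← Matrix.single_mul_single_same a o o o b, hmul, bm.sum_r_single, bm.sum_l_single]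

theorem corner_one (hunit : ∀ x : M, bm.l 1 x = x ∧ bm.r x 1 = x)
    {δ : Matrix ι ι A → Matrix ι ι M}
    (hmul : ∀ S T i j, δ (S * T) i j =
      ∑ k, bm.r (δ S i k) (T k j) + ∑ k, bm.l (S i k) (δ T k j))
    (o : ι) : δ (Matrix.single o o 1) o o = 0 := by
  have h := bm.corner_leibniz hmul o 1 1
  rw [mul_one, (hunit _).1, (hunit _).2] at h
  exact left_eq_add.mp h

theorem corner_column_eq_neg_row (hunit : ∀ x : M, bm.l 1 x = x ∧ bm.r x 1 = x)
    {δ : Matrix ι ι A → Matrix ι ι M} (hadd : ∀ S T, δ (S + T) = δ S + δ T)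
    (hmul : ∀ S T i j, δ (S * T) i j =
      ∑ k, bm.r (δ S i k) (T k j) + ∑ k, bm.l (S i k) (δ T k j))
    (o i k : ι) :
    δ (Matrix.single k o 1) i o = -δ (Matrix.single o i 1) o k := by
  have h := hmul (Matrix.single o i 1) (Matrix.single k o 1) o o
  rw [bm.sum_r_single, bm.sum_l_single, (hunit _).1, (hunit _).2] at h
  have h0 : δ (Matrix.single o i 1 * Matrix.single k o 1) o o = 0 := by
    by_cases hik : i = k
    · subst hik
      rw [Matrix.single_mul_single_same, mul_one, bm.corner_one hunit hmul]
    · rw [Matrix.single_mul_single_of_ne _ _ _ _ hik]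
      exact congrFun (congrFun (map_zero (AddMonoidHom.mk' δ hadd)) o) o
  rw [h0] at h
  exact eq_neg_of_add_eq_zero_right h.symm

/-- A derivation of matrices is determined by its corner and by an inner derivation. -/
theorem apply_eq_corner_add_inner (hunit : ∀ x : M, bm.l 1 x = x ∧ bm.r x 1 = x)
    {δ : Matrix ι ι A → Matrix ι ι M} (hadd : ∀ S T, δ (S + T) = δ S + δ T)
    (hmul : ∀ S T i j, δ (S * T) i j =
      ∑ k, bm.r (δ S i k) (T k j) + ∑ k, bm.l (S i k) (δ T k j))
    (o : ι) (S : Matrix ι ι A) (i j : ι) :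
    δ S i j = δ (Matrix.single o o (S i j)) o o +
      ∑ k, bm.l (S i k) (δ (Matrix.single o k 1) o j) -
      ∑ k, bm.r (δ (Matrix.single o i 1) o k) (S k j) := by
  have hS : Matrix.single o i 1 * S * Matrix.single j o 1 = Matrix.single o o (S i j) := by
    rw [Matrix.single_mul_mul_single, one_mul, mul_one]
  have hrow : ∀ k, (Matrix.single o i 1 * S : Matrix ι ι A) o k = S i k := fun k => by simp
  have h := hmul (Matrix.single o i 1 * S) (Matrix.single j o 1) o o
  rw [hS, bm.sum_r_single, (hunit _).2, hmul, bm.sum_l_single, (hunit _).1] at h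
  simp only [hrow, bm.corner_column_eq_neg_row hunit hadd hmul o, bm.l_neg,
    Finset.sum_neg_distrib] at h
  rw [h]
  abel

end RingBimod

theorem stmt13 (R N : Type*) [Ring R] [AddCommGroup N] (bm : RingBimod R N)
    (hunit : ∀ x : N, bm.l 1 x = x ∧ bm.r x 1 = x)
    (n : ℕ) (hn : 2 ≤ n) :
    let matL : Matrix (Fin n) (Fin n) R → Matrix (Fin n) (Fin n) N →
        Matrix (Fin n) (Fin n) N := fun A X i j => ∑ k, bm.l (A i k) (X k j)
    let matR : Matrix (Fin n) (Fin n) N → Matrix (Fin n) (Fin n) R →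
        Matrix (Fin n) (Fin n) N := fun X A i j => ∑ k, bm.r (X i k) (A k j)
    let entrywise : (R → N) → Matrix (Fin n) (Fin n) R → Matrix (Fin n) (Fin n) N :=
      fun d A i j => d (A i j)
    -- every derivation d : R → N induces an entrywise derivation
    (∀ d : R → N, (∀ a b, d (a + b) = d a + d b) →
      (∀ a b, d (a * b) = bm.r (d a) b + bm.l a (d b)) →
      ∀ A B : Matrix (Fin n) (Fin n) R,
        entrywise d (A * B) = matR (entrywise d A) B + matL A (entrywise d B)) ∧
    -- every derivation δ : Mₙ(R) → Mₙ(N) is of the form d̄ + (inner derivation by G)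
    (∀ δ : Matrix (Fin n) (Fin n) R → Matrix (Fin n) (Fin n) N,
      (∀ A B, δ (A + B) = δ A + δ B) →
      (∀ A B, δ (A * B) = matR (δ A) B + matL A (δ B)) →
      ∃ (G : Matrix (Fin n) (Fin n) N) (d : R → N),
        (∀ a b, d (a + b) = d a + d b) ∧
        (∀ a b, d (a * b) = bm.r (d a) b + bm.l a (d b)) ∧
        ∀ A, δ A = entrywise d A + matL A G - matR G A) := by
  intro matL matR entrywise
  refine ⟨fun d hadd hmul A B => ?_, fun δ hadd hmul => ?_⟩
  · ext i j
    exact bm.entrywise_leibniz hadd hmul A B i j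
  · have hmul' : ∀ A B i j, δ (A * B) i j =
        ∑ k, bm.r (δ A i k) (B k j) + ∑ k, bm.l (A i k) (δ B k j) :=
      fun A B i j => congrFun (congrFun (hmul A B) i) j
    let o : Fin n := ⟨0, by omega⟩
    refine ⟨fun i k => δ (Matrix.single o i 1) o k, fun a => δ (Matrix.single o o a) o o,
      fun a b => ?_, bm.corner_leibniz hmul' o, fun A => ?_⟩
    · change δ (Matrix.single o o (a + b)) o o = _
      rw [Matrix.single_add, hadd]
      rfl
    · ext i j
      exact bm.apply_eq_corner_add_inner hunit hadd hmul' o A i j
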